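/- Let τ be a k-tangle in a graph G with k ≥ 2, and suppose there exists a (k+1)-tangle in G. Then there is an edge e of G such that τ extends to a k-tangle τ' in G − e. -/

import Mathlib

open Finset

variable {V : Type} [Fintype V] [DecidableEq V]

/-- `{A, B}` is a separation of the graph `G`: the two sides together cover the vertex set and
no edge of `G` joins `A \ B` to `B \ A`. -/
def IsSep (G : SimpleGraph V) (A B : Finset V) : Prop :=
  A ∪ B = Finset.univ ∧ ∀ a ∈ A \ B, ∀ b ∈ B \ A, ¬ G.Adj a b

/-- `G[A₁] ∪ G[A₂] ∪ G[A₃] = G` for the induced subgraphs on `A₁`, `A₂`, `A₃`. -/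
def CoversG (G : SimpleGraph V) (A₁ A₂ A₃ : Finset V) : Prop :=
  (∀ v : V, v ∈ A₁ ∨ v ∈ A₂ ∨ v ∈ A₃) ∧
    ∀ u v : V, G.Adj u v →
      (u ∈ A₁ ∧ v ∈ A₁) ∨ (u ∈ A₂ ∧ v ∈ A₂) ∨ (u ∈ A₃ ∧ v ∈ A₃)

/-- `τ` is a `k`-tangle in `G`: a set of oriented separations of order `< k` containing exactly
one orientation of every separation of order `< k`, and no three of its elements have small
sides whose induced subgraphs together cover `G`. -/
def IsTangle (G : SimpleGraph V) (k : ℕ) (τ : Set (Finset V × Finset V)) : Prop :=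
  (∀ p ∈ τ, IsSep G p.1 p.2 ∧ (p.1 ∩ p.2).card < k) ∧
    (∀ A B : Finset V, IsSep G A B → (A ∩ B).card < k → ((A, B) ∈ τ ↔ (B, A) ∉ τ)) ∧
    ∀ p₁ ∈ τ, ∀ p₂ ∈ τ, ∀ p₃ ∈ τ, ¬ CoversG G p₁.1 p₂.1 p₃.1

lemma isSep_iff {G : SimpleGraph V} {A B : Finset V} :
    IsSep G A B ↔ (∀ x, x ∈ A ∨ x ∈ B) ∧
      ∀ a b, G.Adj a b → (a ∈ A ∧ b ∈ A) ∨ (a ∈ B ∧ b ∈ B) := by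
  have h : A ∪ B = Finset.univ ↔ ∀ x, x ∈ A ∨ x ∈ B := by simp [Finset.ext_iff]
  unfold IsSep
  rw [h]
  refine and_congr_right fun hc => ⟨fun hs a b hab => ?_, fun hs a ha b hb hab => ?_⟩
  · have h1 := hs a
    have h2 := hs b
    have h3 := hc a
    have h4 := hc b
    have h5 := hab.symm
    simp only [Finset.mem_sdiff] at h1 h2
    grind
  · have := hs a b hab
    simp only [Finset.mem_sdiff] at ha hb
    grind

lemma isSep_deleteEdges_iff {G : SimpleGraph V} {A B : Finset V} {u v : V} :
    IsSep (G.deleteEdges {s(u, v)}) A B ↔ (∀ x, x ∈ A ∨ x ∈ B) ∧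
      ∀ a b, G.Adj a b → (a ∈ A ∧ b ∈ A) ∨ (a ∈ B ∧ b ∈ B) ∨
        (a = u ∧ b = v) ∨ (a = v ∧ b = u) := by
  rw [isSep_iff]
  refine and_congr_right fun _ => forall₂_congr fun a b => ?_
  simp only [SimpleGraph.deleteEdges_adj, Set.mem_singleton_iff, Sym2.eq_iff]
  tauto

lemma coversG_deleteEdges_iff {G : SimpleGraph V} {A B C : Finset V} {u v : V} :
    CoversG (G.deleteEdges {s(u, v)}) A B C ↔ (∀ x, x ∈ A ∨ x ∈ B ∨ x ∈ C) ∧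
      ∀ a b, G.Adj a b → (a ∈ A ∧ b ∈ A) ∨ (a ∈ B ∧ b ∈ B) ∨ (a ∈ C ∧ b ∈ C) ∨
        (a = u ∧ b = v) ∨ (a = v ∧ b = u) := by
  refine and_congr_right fun _ => forall₂_congr fun a b => ?_
  simp only [SimpleGraph.deleteEdges_adj, Set.mem_singleton_iff, Sym2.eq_iff]
  tauto

lemma CoversG.rotate {G : SimpleGraph V} {A B C : Finset V} (h : CoversG G A B C) :
    CoversG G B C A := by
  refine ⟨fun x => ?_, fun a b hab => ?_⟩
  · have := h.1 x
    tauto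
  · have := h.2 a b hab
    tauto

lemma IsSep.symm {G : SimpleGraph V} {A B : Finset V} (h : IsSep G A B) : IsSep G B A := by
  rw [isSep_iff] at h ⊢
  exact ⟨fun x => (h.1 x).symm, fun a b hab => (h.2 a b hab).symm⟩

lemma IsSep.inter_union {G : SimpleGraph V} {A B X Y : Finset V} (h : IsSep G A B)
    (h' : IsSep G X Y) : IsSep G (A ∩ X) (B ∪ Y) := by
  rw [isSep_iff] at h h' ⊢
  simp only [Finset.mem_inter, Finset.mem_union]
  refine ⟨fun x => ?_, fun a b hab => ?_⟩
  · have := h.1 x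
    have := h'.1 x
    tauto
  · have := h.2 a b hab
    have := h'.2 a b hab
    tauto

lemma card_corner_add_card_corner_le (A B X Y : Finset V) :
    ((A ∩ X) ∩ (B ∪ Y)).card + ((A ∪ X) ∩ (B ∩ Y)).card ≤
      (A ∩ B).card + (X ∩ Y).card := by
  rw [← Finset.card_union_add_card_inter ((A ∩ X) ∩ (B ∪ Y)),
    ← Finset.card_union_add_card_inter (A ∩ B)]
  refine Nat.add_le_add (Finset.card_le_card fun x => ?_) (Finset.card_le_card fun x => ?_) <;>
  · simp only [Finset.mem_inter, Finset.mem_union]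
    tauto

section Tangle

variable {G : SimpleGraph V} {k : ℕ} {τ : Set (Finset V × Finset V)}

lemma IsTangle.mem_of_coversG (hτ : IsTangle G k τ) {X Y P P' Q Q' : Finset V}
    (hs : IsSep G X Y) (hc : (X ∩ Y).card < k) (hP : (P, P') ∈ τ) (hQ : (Q, Q') ∈ τ)
    (h : CoversG G Y P Q) : (X, Y) ∈ τ := by
  by_contra hn
  have : (Y, X) ∈ τ := by
    by_contra h'
    exact hn ((hτ.2.1 X Y hs hc).2 h')
  exact hτ.2.2 _ this _ hP _ hQ h

lemma IsTangle.mem_of_subset (hτ : IsTangle G k τ) {X Y P Q : Finset V}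
    (hs : IsSep G X Y) (hc : (X ∩ Y).card < k) (hP : (P, Q) ∈ τ) (h : Q ⊆ Y) :
    (X, Y) ∈ τ := by
  have hPQ := isSep_iff.1 (hτ.1 _ hP).1
  refine hτ.mem_of_coversG hs hc hP hP ⟨fun x => ?_, fun a b hab => ?_⟩
  · have := hPQ.1 x
    have := @h x
    tauto
  · have := hPQ.2 a b hab
    have := @h a
    have := @h b
    tauto

lemma IsTangle.mem_univ (hτ : IsTangle G k τ) {S : Finset V} (hS : S.card < k) :
    (S, Finset.univ) ∈ τ := by
  have hs : IsSep G S Finset.univ := isSep_iff.2 (by simp)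
  have hs' : (S ∩ Finset.univ).card < k := by simpa using hS
  by_contra hn
  have h : (Finset.univ, S) ∈ τ := by
    by_contra h'
    exact hn ((hτ.2.1 _ _ hs hs').2 h')
  exact hτ.2.2 _ h _ h _ h (by simp [CoversG])

lemma IsTangle.exists_adj (hτ : IsTangle G k τ) (hk : 2 ≤ k) : ∃ u v, G.Adj u v := by
  by_contra! hG
  obtain ⟨p, hp, hmax⟩ := Set.Finite.exists_maximalFor (fun p : Finset V × Finset V => p.1.card)
    τ (Set.toFinite _) ⟨_, hτ.mem_univ (S := ∅) (by simp; omega)⟩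
  obtain ⟨A, B⟩ := p
  have hAB := hτ.1 _ hp
  rw [isSep_iff] at hAB
  obtain ⟨⟨hu, -⟩, hc⟩ := hAB
  by_cases hA : ∀ x, x ∈ A
  · exact hτ.2.2 _ hp _ hp _ hp ⟨fun x => Or.inl (hA x), fun a b _ => Or.inl ⟨hA a, hA b⟩⟩
  push Not at hA
  obtain ⟨x, hx⟩ := hA
  have hmem : (insert x A, B.erase x) ∈ τ := by
    refine hτ.mem_of_coversG (isSep_iff.2 ⟨fun y => ?_, fun a b hab => (hG a b hab).elim⟩) ?_
      hp (hτ.mem_univ (S := {x}) (by simp; omega)) ⟨fun y => ?_, fun a b hab => (hG a b hab).elim⟩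
    · have := hu y
      simp only [Finset.mem_insert, Finset.mem_erase]
      tauto
    · refine (Finset.card_le_card fun y => ?_).trans_lt hc
      simp only [Finset.mem_insert, Finset.mem_erase, Finset.mem_inter]
      tauto
    · have := hu y
      simp only [Finset.mem_singleton, Finset.mem_erase]
      tauto
  have h1 := hmax hmem
  simp [Finset.card_insert_of_notMem hx] at h1

end Tangle

/-- Add both `u` and `v` to a set that contains one of them. -/
def pairClosure (u v : V) (X : Finset V) : Finset V :=
  if u ∈ X ∨ v ∈ X then X ∪ {u, v} else X

lemma mem_pairClosure {u v x : V} {X : Finset V} :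
    x ∈ pairClosure u v X ↔ x ∈ X ∨ (x = u ∨ x = v) ∧ (u ∈ X ∨ v ∈ X) := by
  unfold pairClosure
  split_ifs with h
  · simp [h]
    tauto
  · simp [h]

lemma exists_pairClosure_subset_insert (u v : V) (X : Finset V) :
    ∃ x, pairClosure u v X ⊆ insert x X := by
  by_cases hu : u ∈ X
  · exact ⟨v, fun y => by simp only [mem_pairClosure, Finset.mem_insert]; grind⟩
  · exact ⟨u, fun y => by simp only [mem_pairClosure, Finset.mem_insert]; grind⟩

lemma card_pairClosure_inter_le (u v : V) (X Y : Finset V) :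
    (pairClosure u v X ∩ Y).card ≤ (X ∩ Y).card + 1 := by
  obtain ⟨x, hx⟩ := exists_pairClosure_subset_insert u v X
  refine (Finset.card_le_card fun y => ?_).trans (Finset.card_insert_le x (X ∩ Y))
  have := @hx y
  simp only [Finset.mem_insert, Finset.mem_inter] at this ⊢
  tauto

lemma isSep_pairClosure {G : SimpleGraph V} {u v : V} {X Y : Finset V}
    (h : IsSep (G.deleteEdges {s(u, v)}) X Y) : IsSep G (pairClosure u v X) Y := by
  rw [isSep_deleteEdges_iff] at h
  rw [isSep_iff]
  simp only [mem_pairClosure]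
  refine ⟨fun x => ?_, fun a b hab => ?_⟩
  · have := h.1 x
    tauto
  · have := h.2 a b hab
    have := h.1 u
    have := h.1 v
    grind

lemma isSep_deleteEdges {G : SimpleGraph V} {u v : V} {X Y : Finset V}
    (h : IsSep G X Y) : IsSep (G.deleteEdges {s(u, v)}) X Y := by
  rw [isSep_deleteEdges_iff]
  rw [isSep_iff] at h
  exact ⟨h.1, fun a b hab => (h.2 a b hab).imp_right Or.inl⟩

lemma coversG_pairClosure {G : SimpleGraph V} {u v : V} {X Y Z : Finset V}
    (h : CoversG (G.deleteEdges {s(u, v)}) X Y Z) :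
    CoversG G (pairClosure u v X) (pairClosure u v Y) (pairClosure u v Z) := by
  rw [coversG_deleteEdges_iff] at h
  simp only [CoversG, mem_pairClosure]
  refine ⟨fun x => ?_, fun a b hab => ?_⟩
  · have := h.1 x
    tauto
  · have := h.2 a b hab
    have := h.1 u
    have := h.1 v
    grind

lemma exists_extension_of_subset {G : SimpleGraph V} {k : ℕ} {τ τs : Set (Finset V × Finset V)}
    (hk : 2 ≤ k) (hτ : IsTangle G k τ) (hτs : IsTangle G (k + 1) τs) (hsub : τ ⊆ τs) (u v : V) :
    ∃ τ', IsTangle (G.deleteEdges {s(u, v)}) k τ' ∧ τ ⊆ τ' := by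
  have hE : (({u, v} : Finset V), Finset.univ) ∈ τs :=
    hτs.mem_univ (Finset.card_le_two.trans_lt (by omega))
  refine ⟨{p | IsSep (G.deleteEdges {s(u, v)}) p.1 p.2 ∧ (p.1 ∩ p.2).card < k ∧
    (pairClosure u v p.1, p.2) ∈ τs}, ⟨fun p hp => ⟨hp.1, hp.2.1⟩, fun X Y hs hc => ?_, ?_⟩, ?_⟩
  · have hs' := isSep_deleteEdges_iff.1 hs
    have hX := isSep_pairClosure hs
    have hXc := (card_pairClosure_inter_le u v X Y).trans_lt (Nat.add_lt_add_right hc 1)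
    have hY := isSep_pairClosure hs.symm
    have hYc := (card_pairClosure_inter_le u v Y X).trans_lt
      (Nat.add_lt_add_right (Finset.inter_comm X Y ▸ hc) 1)
    simp only [Set.mem_ofPred_eq, hs, hs.symm, hc, Finset.inter_comm Y X, true_and]
    constructor
    · refine fun h h' => hτs.2.2 _ h _ h _ h' ⟨fun x => ?_, fun a b hab => ?_⟩
      · have := hs'.1 x
        simp only [mem_pairClosure]
        tauto
      · have := hs'.2 a b hab
        have := hs'.1 u
        have := hs'.1 v
        simp only [mem_pairClosure]
        grind
    · intro h'
      have h2 : (X, pairClosure u v Y) ∈ τs := by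
        by_contra h
        exact h' ((hτs.2.1 _ _ hY hYc).2 h)
      refine hτs.mem_of_coversG hX hXc h2 hE ⟨fun x => ?_, fun a b hab => ?_⟩
      · have := hs'.1 x
        tauto
      · have := hs'.2 a b hab
        simp only [Finset.mem_insert, Finset.mem_singleton]
        grind
  · rintro p ⟨-, -, hp⟩ q ⟨-, -, hq⟩ r ⟨-, -, hr⟩ hcov
    exact hτs.2.2 _ hp _ hq _ hr (coversG_pairClosure hcov)
  · rintro ⟨X, Y⟩ hp
    have h := hτ.1 _ hp
    exact ⟨isSep_deleteEdges h.1, h.2, hτs.mem_of_subset (isSep_pairClosure (isSep_deleteEdges h.1))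
      ((card_pairClosure_inter_le u v X Y).trans_lt (Nat.add_lt_add_right h.2 1))
      (hsub hp) subset_rfl⟩

/-- `(A, B)` distinguishes the tangles `τ` and `τs`, having minimal order, and then minimal
`A`-side, among all such separations. -/
structure IsMinDist (τ τs : Set (Finset V × Finset V)) (A B : Finset V) : Prop where
  mem : (A, B) ∈ τ
  mem' : (B, A) ∈ τs
  of_card_lt : ∀ X Y, (X, Y) ∈ τ → (X ∩ Y).card < (A ∩ B).card → (X, Y) ∈ τs
  of_card_le : ∀ X Y, (X, Y) ∈ τ → (X ∩ Y).card ≤ (A ∩ B).card → X.card < A.card → (X, Y) ∈ τs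

section MinDist

variable {G : SimpleGraph V} {k : ℕ} {τ τs : Set (Finset V × Finset V)} {A B : Finset V}

lemma exists_isMinDist (hτ : IsTangle G k τ) (hτs : IsTangle G (k + 1) τs) (h : ¬ τ ⊆ τs) :
    ∃ A B, IsMinDist τ τs A B := by
  have flip : ∀ X Y, (X, Y) ∈ τ → (X, Y) ∉ τs → (Y, X) ∈ τs := fun X Y hX hn => by
    by_contra h'
    exact hn ((hτs.2.1 X Y (hτ.1 _ hX).1 ((hτ.1 _ hX).2.trans (Nat.lt_succ_self k))).2 h')
  obtain ⟨⟨X, Y⟩, hX, hY⟩ := Set.not_subset.1 h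
  obtain ⟨⟨A, B⟩, ⟨hA, hB⟩, hmin⟩ := Set.Finite.exists_minimalFor
    (fun p : Finset V × Finset V => toLex ((p.1 ∩ p.2).card, p.1.card))
    {p | p ∈ τ ∧ (p.2, p.1) ∈ τs} (Set.toFinite _) ⟨(X, Y), hX, flip X Y hX hY⟩
  have key : ∀ X Y, (X, Y) ∈ τ →
      toLex ((X ∩ Y).card, X.card) < toLex ((A ∩ B).card, A.card) → (X, Y) ∈ τs := by
    intro X Y hX hlt
    by_contra hn
    exact absurd (hmin (j := (X, Y)) ⟨hX, flip X Y hX hn⟩ hlt.le) (not_le.2 hlt)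
  refine ⟨A, B, hA, hB, fun X Y hX hlt => key X Y hX ?_, fun X Y hX hle hlt => key X Y hX ?_⟩
  · exact Prod.Lex.toLex_lt_toLex.2 (Or.inl hlt)
  · rcases hle.lt_or_eq with h | h
    · exact Prod.Lex.toLex_lt_toLex.2 (Or.inl h)
    · exact Prod.Lex.toLex_lt_toLex.2 (Or.inr ⟨h, hlt⟩)

lemma IsMinDist.exists_adj (h : IsMinDist τ τs A B) (hk : 2 ≤ k) (hτ : IsTangle G k τ)
    (hτs : IsTangle G (k + 1) τs) : ∃ u ∈ A, ∃ v ∈ A, G.Adj u v := by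
  have hAB := isSep_iff.1 (hτ.1 _ h.mem).1
  have hc := (hτ.1 _ h.mem).2
  obtain ⟨x, hx⟩ : ∃ x, x ∉ B := by
    by_contra! hB
    exact hτs.2.2 _ h.mem' _ h.mem' _ h.mem'
      ⟨fun x => Or.inl (hB x), fun a b _ => Or.inl ⟨hB a, hB b⟩⟩
  have hxA : x ∈ A := (hAB.1 x).resolve_right hx
  by_contra! hG
  have hcard : ((A.erase x) ∩ (insert x B)).card ≤ (A ∩ B).card := by
    refine Finset.card_le_card fun y => ?_
    simp only [Finset.mem_insert, Finset.mem_erase, Finset.mem_inter]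
    tauto
  have hmem : (A.erase x, insert x B) ∈ τ := by
    refine hτ.mem_of_subset (isSep_iff.2 ⟨fun y => ?_, fun a b hab => ?_⟩)
      (hcard.trans_lt hc) h.mem (Finset.subset_insert x B)
    · have := hAB.1 y
      simp only [Finset.mem_insert, Finset.mem_erase]
      tauto
    · have := hAB.2 a b hab
      have := hG a
      have := hG b
      simp only [Finset.mem_insert, Finset.mem_erase]
      grind
  have hmem' := h.of_card_le _ _ hmem hcard (Finset.card_erase_lt_of_mem hxA)
  refine hτs.2.2 _ h.mem' _ hmem' _ (hτs.mem_univ (S := {x}) (by simp; omega))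
    ⟨fun y => ?_, fun a b hab => ?_⟩
  · have := hAB.1 y
    simp only [Finset.mem_singleton, Finset.mem_erase]
    tauto
  · have := hAB.2 a b hab
    have := hG a
    grind

variable {u v : V} {X Y : Finset V}

lemma IsMinDist.inter_pairClosure_mem (h : IsMinDist τ τs A B) (hk : 2 ≤ k) (hτ : IsTangle G k τ)
    (hτs : IsTangle G (k + 1) τs) (hu : u ∈ A) (hv : v ∈ A)
    (hs : IsSep (G.deleteEdges {s(u, v)}) X Y) (hc : (X ∩ Y).card < k)
    (hw : k ≤ ((A ∪ X) ∩ (B ∩ Y)).card) : (A ∩ pairClosure u v X, B ∪ Y) ∈ τs := by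
  have hE : (({u, v} : Finset V), Finset.univ) ∈ τs :=
    hτs.mem_univ (Finset.card_le_two.trans_lt (by omega))
  have hAB := hτ.1 _ h.mem
  have hAB' := isSep_iff.1 hAB.1
  have hs' := isSep_deleteEdges_iff.1 hs
  have hsub := card_corner_add_card_corner_le A B X Y
  have hlt : ((A ∩ X) ∩ (B ∪ Y)).card < (A ∩ B).card := by omega
  have hcard : ((A ∩ pairClosure u v X) ∩ (B ∪ Y)).card ≤ (A ∩ B).card := by
    have h1 := card_pairClosure_inter_le u v X (A ∩ (B ∪ Y))
    rw [← Finset.inter_assoc, ← Finset.inter_assoc, Finset.inter_comm _ A,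
      Finset.inter_comm X A] at h1
    omega
  have hsep := IsSep.inter_union hAB.1 (isSep_pairClosure hs)
  have hmem : (A ∩ pairClosure u v X, B ∪ Y) ∈ τ :=
    hτ.mem_of_subset hsep (hcard.trans_lt hAB.2) h.mem Finset.subset_union_left
  by_cases hXA : (A ∩ pairClosure u v X).card < A.card
  · exact h.of_card_le _ _ hmem hcard hXA
  have hAX : A ∩ pairClosure u v X = A :=
    Finset.eq_of_subset_of_card_le Finset.inter_subset_left (not_lt.1 hXA)
  by_cases hX : A ⊆ X
  · have : pairClosure u v X = X := by
      ext x
      have := hX hu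
      have := hX hv
      rw [mem_pairClosure]
      grind
    rw [this] at hmem ⊢
    exact h.of_card_lt _ _ hmem hlt
  have hAY : A ∩ B = A ∩ (B ∪ Y) := by
    rw [hAX] at hcard
    exact Finset.eq_of_subset_of_card_le
      (Finset.inter_subset_inter_left Finset.subset_union_left) hcard
  have hYB : ∀ y, y ∈ A → y ∈ Y → y ∈ B := fun y hy hyY => by
    have : y ∈ A ∩ B := hAY ▸ Finset.mem_inter.2 ⟨hy, Finset.mem_union_right _ hyY⟩
    exact (Finset.mem_inter.1 this).2
  have hAX' : ∀ y, y ∈ A → y ∈ X ∨ (y = u ∨ y = v) ∧ (u ∈ X ∨ v ∈ X) := fun y hy => by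
    rw [← hAX] at hy
    exact mem_pairClosure.1 (Finset.mem_inter.1 hy).2
  obtain ⟨x, hxA, hxX⟩ := Finset.not_subset.1 hX
  have hAx : ∀ y, y ∈ A → y ∈ X ∨ y = x := fun y hy => by
    have h1 := hAX' y hy
    have h2 := hAX' x hxA
    clear * - h1 h2 hxX
    grind
  have hcard' : ((A ∩ X) ∩ (B ∪ (Y ∪ {u, v}))).card ≤ (A ∩ B).card := by
    obtain ⟨z, hz⟩ : ∃ z, (A ∩ X) ∩ (B ∪ (Y ∪ {u, v})) ⊆ insert z ((A ∩ X) ∩ (B ∪ Y)) := by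
      have := hAX' x hxA
      by_cases hxu : x = u
      · refine ⟨v, fun y => ?_⟩
        simp only [Finset.mem_insert, Finset.mem_inter, Finset.mem_union, Finset.mem_singleton]
        grind
      · refine ⟨u, fun y => ?_⟩
        simp only [Finset.mem_insert, Finset.mem_inter, Finset.mem_union, Finset.mem_singleton]
        grind
    have := (Finset.card_le_card hz).trans (Finset.card_insert_le _ _)
    omega
  have hsep' : IsSep G (A ∩ X) (B ∪ (Y ∪ {u, v})) := by
    refine IsSep.inter_union hAB.1 (isSep_iff.2 ⟨fun y => ?_, fun a b hab => ?_⟩)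
    · have := hs'.1 y
      simp only [Finset.mem_union]
      tauto
    · have := hs'.2 a b hab
      simp only [Finset.mem_insert, Finset.mem_union, Finset.mem_singleton]
      tauto
  have hmem' : (A ∩ X, B ∪ (Y ∪ {u, v})) ∈ τs := by
    refine h.of_card_le _ _ (hτ.mem_of_subset hsep' (hcard'.trans_lt hAB.2) h.mem
      Finset.subset_union_left) hcard' (Finset.card_lt_card ?_)
    exact ⟨Finset.inter_subset_left, fun hA => hxX (Finset.mem_inter.1 (hA hxA)).2⟩
  refine (hτs.2.2 _ h.mem' _ hmem' _ hE ⟨fun y => ?_, fun a b hab => ?_⟩).elim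
  · have h1 := hAB'.1 y
    have h2 := hAX' y
    simp only [Finset.mem_insert, Finset.mem_inter, Finset.mem_singleton]
    clear * - h1 h2
    tauto
  · simp only [Finset.mem_insert, Finset.mem_inter, Finset.mem_singleton]
    rcases hAB'.2 a b hab with hab' | hab'
    · have hxB := hYB x hxA ((hs'.1 x).resolve_left hxX)
      have h1 := hs'.2 a b hab
      have h2 := hAx a hab'.1
      have h3 := hAx b hab'.2
      have h4 := hYB a hab'.1
      have h5 := hYB b hab'.2
      clear * - hab' h1 h2 h3 h4 h5 hxB hxX
      grind
    · exact Or.inl hab'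

lemma IsMinDist.card_lt_or_card_lt (h : IsMinDist τ τs A B) (hk : 2 ≤ k) (hτ : IsTangle G k τ)
    (hτs : IsTangle G (k + 1) τs) (hu : u ∈ A) (hv : v ∈ A)
    (hs : IsSep (G.deleteEdges {s(u, v)}) X Y) (hc : (X ∩ Y).card < k) :
    ((A ∪ X) ∩ (B ∩ Y)).card < k ∨ ((A ∪ Y) ∩ (B ∩ X)).card < k := by
  by_contra! hn
  have h1 := h.inter_pairClosure_mem hk hτ hτs hu hv hs hc hn.1
  have h2 := h.inter_pairClosure_mem hk hτ hτs hu hv hs.symm (Finset.inter_comm X Y ▸ hc) hn.2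
  have hAB := isSep_iff.1 (hτ.1 _ h.mem).1
  have hs' := isSep_deleteEdges_iff.1 hs
  refine hτs.2.2 _ h.mem' _ h1 _ h2 ⟨fun y => ?_, fun a b hab => ?_⟩
  · have := hAB.1 y
    have := hs'.1 y
    simp only [Finset.mem_inter, mem_pairClosure]
    tauto
  · have := hAB.2 a b hab
    have := hs'.2 a b hab
    have := hs'.1 u
    have := hs'.1 v
    simp only [Finset.mem_inter, mem_pairClosure]
    grind

lemma IsMinDist.union_mem_or_pairClosure_mem (h : IsMinDist τ τs A B) (hk : 2 ≤ k) (hτ : IsTangle G k τ)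
    (hτs : IsTangle G (k + 1) τs) (hu : u ∈ A) (hv : v ∈ A)
    (hs : IsSep (G.deleteEdges {s(u, v)}) X Y) (hc : (X ∩ Y).card < k)
    (hw : k ≤ ((A ∪ X) ∩ (B ∩ Y)).card)
    (hX : (B ∩ X ∩ (A ∪ Y)).card < k → (B ∩ X, A ∪ Y) ∈ τ) :
    (B ∪ pairClosure u v X, A ∩ Y) ∈ τs ∨ (pairClosure u v X, Y) ∈ τs := by
  have h1 := h.inter_pairClosure_mem hk hτ hτs hu hv hs hc hw
  have hAB := hτ.1 _ h.mem
  have hABc : (A ∩ B).card < k := hAB.2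
  have hAB' := isSep_iff.1 hAB.1
  have hs' := isSep_deleteEdges_iff.1 hs
  have hsep := isSep_pairClosure hs
  by_cases hlt : ((B ∪ pairClosure u v X) ∩ (A ∩ Y)).card < k + 1
  · left
    refine hτs.mem_of_coversG (IsSep.inter_union hAB.1 hsep.symm).symm hlt h.mem' h1
      ⟨fun y => ?_, fun a b hab => ?_⟩
    · have := hAB'.1 y
      have := (isSep_iff.1 hsep).1 y
      simp only [Finset.mem_inter]
      tauto
    · have := hAB'.2 a b hab
      have := (isSep_iff.1 hsep).2 a b hab
      simp only [Finset.mem_inter]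
      tauto
  · right
    have h2 : k ≤ ((B ∪ X) ∩ (A ∩ Y)).card := by
      obtain ⟨x, hx⟩ := exists_pairClosure_subset_insert u v X
      have h3 : (B ∪ pairClosure u v X) ∩ (A ∩ Y) ⊆ insert x ((B ∪ X) ∩ (A ∩ Y)) := fun y => by
        have := @hx y
        simp only [Finset.mem_insert, Finset.mem_inter, Finset.mem_union] at this ⊢
        tauto
      have := (Finset.card_le_card h3).trans (Finset.card_insert_le _ _)
      omega
    have hsub := card_corner_add_card_corner_le B A X Y
    rw [Finset.inter_comm B A] at hsub
    have h4 : (B ∩ X, A ∪ Y) ∈ τs := h.of_card_lt _ _ (hX (by omega)) (by omega)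
    refine hτs.mem_of_coversG hsep
      ((card_pairClosure_inter_le u v X Y).trans_lt (Nat.add_lt_add_right hc 1)) h1 h4
      ⟨fun y => ?_, fun a b hab => ?_⟩
    · have h5 := hAB'.1 y
      have h6 := hs'.1 y
      simp only [Finset.mem_inter, mem_pairClosure]
      clear * - h5 h6
      tauto
    · simp only [Finset.mem_inter, mem_pairClosure]
      have h5 := hs'.1 u
      have h6 := hs'.1 v
      have h7 := hAB'.2 a b hab
      clear * - h5 h6 h7 hu hv hs' hab
      rcases hs'.2 a b hab with h8 | h8 | ⟨rfl, rfl⟩ | ⟨rfl, rfl⟩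
      · rcases h7 with h7 | h7
        · exact Or.inr (Or.inl ⟨⟨h7.1, Or.inl h8.1⟩, h7.2, Or.inl h8.2⟩)
        · exact Or.inr (Or.inr ⟨⟨h7.1, h8.1⟩, h7.2, h8.2⟩)
      · exact Or.inl h8
      · clear * - h5 h6 hu hv
        grind
      · clear * - h5 h6 hu hv
        grind

/-- The extension of `τ` to `G - uv` determined by a minimal distinguishing separation. -/
def tangleExtension (G : SimpleGraph V) (k : ℕ) (τ : Set (Finset V × Finset V)) (A B : Finset V)
    (u v : V) : Set (Finset V × Finset V) :=
  {p | p ∈ τ ∨ (IsSep (G.deleteEdges {s(u, v)}) p.1 p.2 ∧ (p.1 ∩ p.2).card < k ∧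
    ¬ IsSep G p.1 p.2 ∧ ((A ∪ p.1, B ∩ p.2) ∈ τ ∨
      k ≤ ((A ∪ p.1) ∩ (B ∩ p.2)).card ∧ (B ∩ p.1, A ∪ p.2) ∈ τ))}

lemma isSep_union_inter (hAB : IsSep G A B) (hu : u ∈ A) (hv : v ∈ A)
    (hs : IsSep (G.deleteEdges {s(u, v)}) X Y) : IsSep G (A ∪ X) (B ∩ Y) := by
  rw [isSep_iff] at hAB ⊢
  rw [isSep_deleteEdges_iff] at hs
  refine ⟨fun y => ?_, fun a b hab => ?_⟩
  · have := hAB.1 y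
    have := hs.1 y
    simp only [Finset.mem_inter, Finset.mem_union]
    tauto
  · have := hAB.2 a b hab
    have := hs.2 a b hab
    simp only [Finset.mem_inter, Finset.mem_union]
    grind

set_option maxHeartbeats 1000000 in
lemma IsMinDist.isTangle_tangleExtension (h : IsMinDist τ τs A B) (hk : 2 ≤ k) (hτ : IsTangle G k τ)
    (hτs : IsTangle G (k + 1) τs) (hu : u ∈ A) (hv : v ∈ A) :
    IsTangle (G.deleteEdges {s(u, v)}) k (tangleExtension G k τ A B u v) := by
  have hAB := hτ.1 _ h.mem
  have hAB' := isSep_iff.1 hAB.1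
  have hsep : ∀ p ∈ tangleExtension G k τ A B u v,
      IsSep (G.deleteEdges {s(u, v)}) p.1 p.2 ∧ (p.1 ∩ p.2).card < k := by
    rintro p (hp | hp)
    · exact ⟨isSep_deleteEdges (hτ.1 _ hp).1, (hτ.1 _ hp).2⟩
    · exact ⟨hp.1, hp.2.1⟩
  have strong : ∀ p ∈ tangleExtension G k τ A B u v, ((A ∪ p.1) ∩ (B ∩ p.2)).card < k →
      (A ∪ p.1, B ∩ p.2) ∈ τ := by
    rintro ⟨X, Y⟩ hp hlt
    have hs := (hsep _ hp).1
    rcases hp with hp | ⟨-, -, -, hp | hp⟩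
    · have hXY := isSep_iff.1 (hτ.1 _ hp).1
      refine hτ.mem_of_coversG (isSep_union_inter hAB.1 hu hv hs) hlt h.mem hp
        ⟨fun y => ?_, fun a b hab => ?_⟩
      · have := hAB'.1 y
        have := hXY.1 y
        simp only [Finset.mem_inter]
        tauto
      · have := hAB'.2 a b hab
        have := hXY.2 a b hab
        simp only [Finset.mem_inter]
        tauto
    · exact hp
    · exact absurd hlt (not_lt.2 hp.1)
  have weak : ∀ p ∈ tangleExtension G k τ A B u v, k ≤ ((A ∪ p.1) ∩ (B ∩ p.2)).card →
      (B ∩ p.1 ∩ (A ∪ p.2)).card < k → (B ∩ p.1, A ∪ p.2) ∈ τ := by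
    rintro ⟨X, Y⟩ hp hge hlt
    rcases hp with hp | ⟨-, -, -, hp | hp⟩
    · exact hτ.mem_of_subset (IsSep.inter_union hAB.1.symm (hτ.1 _ hp).1) hlt hp
        Finset.subset_union_right
    · exact absurd (hτ.1 _ hp).2 (not_lt.2 hge)
    · exact hp.2
  have supset : ∀ p ∈ tangleExtension G k τ A B u v, ∃ q ∈ τ, B ∩ p.1 ⊆ q.1 := by
    rintro ⟨X, Y⟩ (hp | ⟨-, -, -, hp | hp⟩)
    · exact ⟨_, hp, Finset.inter_subset_right⟩
    · exact ⟨_, hp, Finset.inter_subset_right.trans Finset.subset_union_right⟩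
    · exact ⟨_, hp.2, subset_rfl⟩
  have nocover : ∀ p ∈ tangleExtension G k τ A B u v, ∀ q ∈ tangleExtension G k τ A B u v,
      ∀ r ∈ tangleExtension G k τ A B u v, ((A ∪ p.1) ∩ (B ∩ p.2)).card < k →
      ¬ CoversG (G.deleteEdges {s(u, v)}) p.1 q.1 r.1 := by
    intro p hp q hq r hr hlt hcov
    obtain ⟨q', hq', hqq⟩ := supset q hq
    obtain ⟨r', hr', hrr⟩ := supset r hr
    rw [coversG_deleteEdges_iff] at hcov
    refine hτ.2.2 _ (strong p hp hlt) _ hq' _ hr' ⟨fun y => ?_, fun a b hab => ?_⟩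
    · have := hAB'.1 y
      have := hcov.1 y
      have := @hqq y
      have := @hrr y
      simp only [Finset.mem_inter, Finset.mem_union] at *
      tauto
    · have := hAB'.2 a b hab
      have := hcov.2 a b hab
      have := @hqq a
      have := @hrr a
      have := @hqq b
      have := @hrr b
      simp only [Finset.mem_inter, Finset.mem_union] at *
      grind
  refine ⟨hsep, fun X Y hs hc => ?_, fun p hp q hq r hr hcov => ?_⟩
  · have hXY := isSep_union_inter hAB.1 hu hv hs
    have hYX := isSep_union_inter hAB.1 hu hv hs.symm
    have hs' := isSep_deleteEdges_iff.1 hs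
    constructor
    · intro hX hY
      have hcX : CoversG (G.deleteEdges {s(u, v)}) X Y Y :=
        coversG_deleteEdges_iff.2 ⟨fun y => by have := hs'.1 y; tauto,
          fun a b hab => by have := hs'.2 a b hab; tauto⟩
      have hcY : CoversG (G.deleteEdges {s(u, v)}) Y X X :=
        coversG_deleteEdges_iff.2 ⟨fun y => by have := hs'.1 y; tauto,
          fun a b hab => by have := hs'.2 a b hab; tauto⟩
      rcases h.card_lt_or_card_lt hk hτ hτs hu hv hs hc with hlt | hlt
      · exact nocover _ hX _ hY _ hY hlt hcX
      · exact nocover _ hY _ hX _ hX hlt hcY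
    · intro hY
      by_cases hG : IsSep G X Y
      · exact Or.inl ((hτ.2.1 X Y hG hc).2 fun h' => hY (Or.inl h'))
      have hG' : ¬ IsSep G Y X := fun h' => hG h'.symm
      have hY1 : (A ∪ Y, B ∩ X) ∉ τ := fun h' =>
        hY (Or.inr ⟨hs.symm, Finset.inter_comm X Y ▸ hc, hG', Or.inl h'⟩)
      by_cases hYk : k ≤ ((A ∪ Y) ∩ (B ∩ X)).card
      · have hY2 : (B ∩ Y, A ∪ X) ∉ τ := fun h' =>
          hY (Or.inr ⟨hs.symm, Finset.inter_comm X Y ▸ hc, hG', Or.inr ⟨hYk, h'⟩⟩)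
        have hlt := (h.card_lt_or_card_lt hk hτ hτs hu hv hs hc).resolve_right (not_lt.2 hYk)
        exact Or.inr ⟨hs, hc, hG, Or.inl ((hτ.2.1 _ _ hXY hlt).2 hY2)⟩
      · have hmem : (B ∩ X, A ∪ Y) ∈ τ := by
          by_contra h'
          exact hY1 ((hτ.2.1 _ _ hYX (not_le.1 hYk)).2 h')
        by_cases hXk : k ≤ ((A ∪ X) ∩ (B ∩ Y)).card
        · exact Or.inr ⟨hs, hc, hG, Or.inr ⟨hXk, hmem⟩⟩
        · refine Or.inr ⟨hs, hc, hG, Or.inl (hτ.mem_of_coversG hXY (not_le.1 hXk) h.mem hmem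
            ⟨fun y => ?_, fun a b hab => ?_⟩)⟩
          · have := hAB'.1 y
            have := hs'.1 y
            simp only [Finset.mem_inter]
            tauto
          · have := hAB'.2 a b hab
            have := hs'.2 a b hab
            simp only [Finset.mem_inter]
            grind
  · have hpk := not_lt.1 fun hlt => nocover p hp q hq r hr hlt hcov
    have hqk := not_lt.1 fun hlt => nocover q hq r hr p hp hlt hcov.rotate
    have hrk := not_lt.1 fun hlt => nocover r hr p hp q hq hlt hcov.rotate.rotate
    have inter : ∀ p ∈ tangleExtension G k τ A B u v, k ≤ ((A ∪ p.1) ∩ (B ∩ p.2)).card →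
        (A ∩ pairClosure u v p.1, B ∪ p.2) ∈ τs := fun p hp hge =>
      h.inter_pairClosure_mem hk hτ hτs hu hv (hsep p hp).1 (hsep p hp).2 hge
    have nounion : ∀ p ∈ tangleExtension G k τ A B u v, ∀ q ∈ tangleExtension G k τ A B u v,
        ∀ r ∈ tangleExtension G k τ A B u v, k ≤ ((A ∪ p.1) ∩ (B ∩ p.2)).card →
        k ≤ ((A ∪ q.1) ∩ (B ∩ q.2)).card → k ≤ ((A ∪ r.1) ∩ (B ∩ r.2)).card →
        CoversG (G.deleteEdges {s(u, v)}) p.1 q.1 r.1 → (pairClosure u v p.1, p.2) ∈ τs := by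
      intro p hp q hq r hr hpk hqk hrk hcov
      refine (h.union_mem_or_pairClosure_mem hk hτ hτs hu hv (hsep p hp).1 (hsep p hp).2 hpk
        (weak p hp hpk)).resolve_left fun hun => ?_
      have hcov' := coversG_pairClosure hcov
      refine hτs.2.2 _ hun _ (inter q hq hqk) _ (inter r hr hrk) ⟨fun y => ?_, fun a b hab => ?_⟩
      · have := hAB'.1 y
        have := hcov'.1 y
        simp only [Finset.mem_inter, Finset.mem_union]
        tauto
      · simp only [Finset.mem_inter, Finset.mem_union]
        rcases hAB'.2 a b hab with hab' | hab'
        · rcases hcov'.2 a b hab with hX | hX | hX <;> simp only [hab', hX, true_and, true_or,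
            or_true]
        · exact Or.inl ⟨Or.inl hab'.1, Or.inl hab'.2⟩
    exact hτs.2.2 _ (nounion p hp q hq r hr hpk hqk hrk hcov)
      _ (nounion q hq r hr p hp hqk hrk hpk hcov.rotate)
      _ (nounion r hr p hp q hq hrk hpk hqk hcov.rotate.rotate)
      (coversG_pairClosure hcov)

end MinDist


/-- If `τ` is a `k`-tangle (`k ≥ 2`) in `G` and there exists a `(k+1)`-tangle in `G`, then
there is an edge `e` of `G` such that `τ` extends to a `k`-tangle in `G - e`. -/
theorem stmt10 (k : ℕ) (hk : 2 ≤ k) (G : SimpleGraph V)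
    (τ : Set (Finset V × Finset V)) (hτ : IsTangle G k τ)
    (τstar : Set (Finset V × Finset V)) (hτstar : IsTangle G (k + 1) τstar) :
    ∃ e ∈ G.edgeSet, ∃ τ' : Set (Finset V × Finset V),
      IsTangle (G.deleteEdges {e}) k τ' ∧ τ ⊆ τ' := by
  by_cases hsub : τ ⊆ τstar
  · obtain ⟨u, v, huv⟩ := hτ.exists_adj hk
    obtain ⟨τ', hτ', hsub'⟩ := exists_extension_of_subset hk hτ hτstar hsub u v
    exact ⟨s(u, v), huv, τ', hτ', hsub'⟩
  · obtain ⟨A, B, h⟩ := exists_isMinDist hτ hτstar hsub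
    obtain ⟨u, hu, v, hv, huv⟩ := h.exists_adj hk hτ hτstar
    exact ⟨s(u, v), huv, tangleExtension G k τ A B u v, h.isTangle_tangleExtension hk hτ hτstar hu hv,
      fun p hp => Or.inl hp⟩
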